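/- Locality of the minimal weak upper gradient: let p ∈ (1,∞), h : X → Y measurable with UG^p_loc(h) ≠ ∅, and g ∈ L^p_loc(m). Then g = ρ_h m-a.e. (g equals the minimal weak upper gradient of h) if and only if g|_U = ρ_{h|_U} m-a.e. for every open set U ⊆ X. -/

import Mathlib

open MeasureTheory Set ENNReal Filter

/-- A curve in a metric space: a continuous map from a compact interval `[a,b]`. -/
structure Curve (X : Type*) [MetricSpace X] where
  a : ℝ
  b : ℝ
  hab : a ≤ b
  toFun : ℝ → X
  cont : ContinuousOn toFun (Set.Icc a b)

namespace Curve

variable {X : Type*} [MetricSpace X]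

/-- A curve is rectifiable if it has finite total variation. -/
def Rectifiable (γ : Curve X) : Prop :=
  eVariationOn γ.toFun (Set.Icc γ.a γ.b) ≠ ⊤

/-- The length of a curve: its total variation. -/
noncomputable def length (γ : Curve X) : ℝ :=
  (eVariationOn γ.toFun (Set.Icc γ.a γ.b)).toReal

/-- Arclength up to time `t`. -/
noncomputable def arclen (γ : Curve X) (t : ℝ) : ℝ :=
  (eVariationOn γ.toFun (Set.Icc γ.a t)).toReal

/-- The unit speed parametrization of a curve. -/
noncomputable def unitParam (γ : Curve X) (s : ℝ) : X :=
  γ.toFun (sInf {t | t ∈ Set.Icc γ.a γ.b ∧ s ≤ γ.arclen t})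

/-- The path integral `∫_γ ρ ds` of a Borel function along a curve, computed along
the unit speed parametrization. -/
noncomputable def pathIntegral (γ : Curve X) (ρ : X → ℝ≥0∞) : ℝ≥0∞ :=
  ∫⁻ s in Set.Icc 0 γ.length, ρ (γ.unitParam s)

/-- A curve is absolutely continuous if its increments are bounded by the integral of
an integrable function. -/
def IsAC (γ : Curve X) : Prop :=
  ∃ h : ℝ → ℝ, IntegrableOn h (Set.Icc γ.a γ.b) ∧
    ∀ s t, γ.a ≤ s → s ≤ t → t ≤ γ.b →
      dist (γ.toFun s) (γ.toFun t) ≤ ∫ r in s..t, h r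

/-- The image curve under a continuous map. -/
def map (γ : Curve X) {Y : Type*} [MetricSpace Y] (φ : X → Y) (hφ : Continuous φ) :
    Curve Y :=
  ⟨γ.a, γ.b, γ.hab, φ ∘ γ.toFun, hφ.comp_continuousOn γ.cont⟩

/-- A curve lies in a set `U`. -/
def In (γ : Curve X) (U : Set X) : Prop :=
  ∀ t ∈ Set.Icc γ.a γ.b, γ.toFun t ∈ U

end Curve

/-- Admissibility of a Borel function for a curve family. -/
def Admissible {X : Type*} [MetricSpace X] [MeasurableSpace X]
    (ρ : X → ℝ≥0∞) (Γ : Set (Curve X)) : Prop :=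
  Measurable ρ ∧ ∀ γ ∈ Γ, γ.Rectifiable → 1 ≤ γ.pathIntegral ρ

/-- The conformal `p`-modulus of a curve family. -/
noncomputable def PMod {X : Type*} [MetricSpace X] [MeasurableSpace X]
    (p : ℝ) (m : Measure X) (Γ : Set (Curve X)) : ℝ≥0∞ :=
  ⨅ (ρ : X → ℝ≥0∞) (_ : Admissible ρ Γ), ∫⁻ x, ρ x ^ p ∂m

/-- `g` is a `p`-weak upper gradient of `h : X → Y`: the upper gradient inequality
holds along `Mod_p`-almost every curve. -/
def IsWUG {X : Type*} [MetricSpace X] [MeasurableSpace X] {Y : Type*} [PseudoMetricSpace Y]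
    (p : ℝ) (m : Measure X) (h : X → Y) (g : X → ℝ≥0∞) : Prop :=
  Measurable g ∧ ∃ N : Set (Curve X), PMod p m N = 0 ∧
    ∀ γ : Curve X, γ ∉ N → γ.Rectifiable →
      ENNReal.ofReal (dist (h (γ.toFun γ.a)) (h (γ.toFun γ.b))) ≤ γ.pathIntegral g

/-- `g` is a `p`-weak upper gradient of `h` on the set `U` (with respect to the
restricted measure and curves lying in `U`). -/
def IsWUGOn {X : Type*} [MetricSpace X] [MeasurableSpace X] {Y : Type*} [PseudoMetricSpace Y]
    (p : ℝ) (m : Measure X) (U : Set X) (h : X → Y) (g : X → ℝ≥0∞) : Prop :=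
  Measurable g ∧ ∃ N : Set (Curve X), PMod p (m.restrict U) N = 0 ∧
    ∀ γ : Curve X, γ.In U → γ ∉ N → γ.Rectifiable →
      ENNReal.ofReal (dist (h (γ.toFun γ.a)) (h (γ.toFun γ.b))) ≤ γ.pathIntegral g

/-- Local `p`-integrability of a nonnegative Borel function. -/
def LocPInt {X : Type*} [MetricSpace X] [MeasurableSpace X]
    (p : ℝ) (m : Measure X) (g : X → ℝ≥0∞) : Prop :=
  ∀ x : X, ∃ U : Set X, IsOpen U ∧ x ∈ U ∧ ∫⁻ y in U, g y ^ p ∂m < ⊤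

/-- Local `p`-integrability on a subset. -/
def LocPIntOn {X : Type*} [MetricSpace X] [MeasurableSpace X]
    (p : ℝ) (m : Measure X) (U : Set X) (g : X → ℝ≥0∞) : Prop :=
  ∀ x ∈ U, ∃ V : Set X, IsOpen V ∧ x ∈ V ∧ ∫⁻ y in V ∩ U, g y ^ p ∂m < ⊤

namespace Curve

variable {X : Type*} [MetricSpace X]

/-- Restriction of a curve to a subinterval. -/
def sub (γ : Curve X) (s t : ℝ) (hs : γ.a ≤ s) (hst : s ≤ t) (ht : t ≤ γ.b) : Curve X :=
  ⟨s, t, hst, γ.toFun, γ.cont.mono (Set.Icc_subset_Icc hs ht)⟩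

theorem evar_add (γ : Curve X) {s t : ℝ} (hs : γ.a ≤ s) (hst : s ≤ t) :
    eVariationOn γ.toFun (Set.Icc γ.a s) + eVariationOn γ.toFun (Set.Icc s t)
      = eVariationOn γ.toFun (Set.Icc γ.a t) := by
  have := eVariationOn.Icc_add_Icc γ.toFun (s := Set.univ) hs hst (Set.mem_univ s)
  simpa using this

theorem evar_ne_top {γ : Curve X} (hγ : γ.Rectifiable) {s t : ℝ} (hs : γ.a ≤ s) (ht : t ≤ γ.b) :
    eVariationOn γ.toFun (Set.Icc s t) ≠ ⊤ :=
  ne_top_of_le_ne_top hγ (eVariationOn.mono _ (Set.Icc_subset_Icc hs ht))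

theorem sub_rectifiable {γ : Curve X} (hγ : γ.Rectifiable) {s t : ℝ} (hs : γ.a ≤ s) (hst : s ≤ t)
    (ht : t ≤ γ.b) : (γ.sub s t hs hst ht).Rectifiable :=
  evar_ne_top hγ hs ht

theorem arclen_add {γ : Curve X} (hγ : γ.Rectifiable) {s t : ℝ} (hs : γ.a ≤ s) (hst : s ≤ t)
    (ht : t ≤ γ.b) :
    γ.arclen s + (eVariationOn γ.toFun (Set.Icc s t)).toReal = γ.arclen t := by
  unfold arclen
  rw [← γ.evar_add hs hst, ENNReal.toReal_add (evar_ne_top hγ le_rfl (hst.trans ht))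
    (evar_ne_top hγ hs ht)]

theorem arclen_mono {γ : Curve X} (hγ : γ.Rectifiable) {s t : ℝ} (hs : γ.a ≤ s) (hst : s ≤ t)
    (ht : t ≤ γ.b) : γ.arclen s ≤ γ.arclen t := by
  rw [← arclen_add hγ hs hst ht]
  exact le_add_of_nonneg_right ENNReal.toReal_nonneg

theorem arclen_a (γ : Curve X) : γ.arclen γ.a = 0 := by
  simp [arclen, eVariationOn.subsingleton]

theorem unitParam_sub {γ : Curve X} (hγ : γ.Rectifiable) {s t : ℝ} (hs : γ.a ≤ s) (hst : s ≤ t)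
    (ht : t ≤ γ.b) {u : ℝ} (hu : 0 < u) (hut : u + γ.arclen s ≤ γ.arclen t) :
    (γ.sub s t hs hst ht).unitParam u = γ.unitParam (u + γ.arclen s) := by
  unfold unitParam
  show γ.toFun _ = γ.toFun _
  congr 1
  have hset : {r | r ∈ Set.Icc s t ∧ u ≤ (γ.sub s t hs hst ht).arclen r}
      = {r | r ∈ Set.Icc γ.a γ.b ∧ u + γ.arclen s ≤ γ.arclen r} ∩ Set.Iic t := by
    ext r
    constructor
    · rintro ⟨⟨h1, h2⟩, h3⟩
      have := arclen_add hγ hs h1 (h2.trans ht)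
      have h3' : u ≤ (eVariationOn γ.toFun (Set.Icc s r)).toReal := h3
      exact ⟨⟨⟨hs.trans h1, h2.trans ht⟩, by linarith⟩, h2⟩
    · rintro ⟨⟨⟨h1, h2⟩, h3⟩, h4⟩
      have hsr : s ≤ r := by
        by_contra hlt
        push Not at hlt
        have := arclen_mono hγ h1 hlt.le (hst.trans ht)
        linarith
      have := arclen_add hγ hs hsr h2
      refine ⟨⟨hsr, h4⟩, ?_⟩
      show u ≤ (eVariationOn γ.toFun (Set.Icc s r)).toReal
      linarith
  have htm : t ∈ {r | r ∈ Set.Icc γ.a γ.b ∧ u + γ.arclen s ≤ γ.arclen r} :=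
    ⟨⟨hs.trans hst, ht⟩, hut⟩
  have hbdd : BddBelow {r | r ∈ Set.Icc γ.a γ.b ∧ u + γ.arclen s ≤ γ.arclen r} :=
    ⟨γ.a, fun r hr => hr.1.1⟩
  show sInf {r | r ∈ Set.Icc s t ∧ u ≤ (γ.sub s t hs hst ht).arclen r} = _
  rw [hset]
  apply le_antisymm
  · refine le_csInf ⟨t, htm⟩ fun r hr => ?_
    rcases le_total r t with hrt | hrt
    · exact csInf_le (hbdd.mono Set.inter_subset_left) ⟨hr, hrt⟩
    · exact (csInf_le (hbdd.mono Set.inter_subset_left) ⟨htm, Set.mem_Iic.2 le_rfl⟩).trans hrt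
  · exact csInf_le_csInf hbdd ⟨t, htm, Set.mem_Iic.2 le_rfl⟩ Set.inter_subset_left

/-- Part of the path integral between two times. -/
noncomputable def partInt (γ : Curve X) (f : X → ℝ≥0∞) (s t : ℝ) : ℝ≥0∞ :=
  ∫⁻ u in Set.Ioc (γ.arclen s) (γ.arclen t), f (γ.unitParam u)

theorem pathIntegral_sub {γ : Curve X} (hγ : γ.Rectifiable) (f : X → ℝ≥0∞) {s t : ℝ}
    (hs : γ.a ≤ s) (hst : s ≤ t) (ht : t ≤ γ.b) :
    (γ.sub s t hs hst ht).pathIntegral f = γ.partInt f s t := by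
  have hadd := arclen_add hγ hs hst ht
  have hlen : (γ.sub s t hs hst ht).length = γ.arclen t - γ.arclen s := by
    show (eVariationOn γ.toFun (Set.Icc s t)).toReal = _
    linarith
  unfold pathIntegral partInt
  rw [hlen, setLIntegral_congr Ioc_ae_eq_Icc.symm]
  have hmp := measurePreserving_add_right (volume : Measure ℝ) (γ.arclen s)
  rw [← hmp.setLIntegral_comp_preimage_emb (measurableEmbedding_addRight _)
    (fun u => f (γ.unitParam u))]
  rw [Set.preimage_add_const_Ioc, sub_self]
  refine setLIntegral_congr_fun measurableSet_Ioc fun u hu => ?_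
  show f _ = f _
  rw [unitParam_sub hγ hs hst ht hu.1 (by linarith [hu.2])]

theorem sub_self_eq (γ : Curve X) : γ.sub γ.a γ.b le_rfl γ.hab le_rfl = γ := rfl

theorem partInt_add {γ : Curve X} (hγ : γ.Rectifiable) (f : X → ℝ≥0∞) {r s t : ℝ}
    (hr : γ.a ≤ r) (hrs : r ≤ s) (hst : s ≤ t) (ht : t ≤ γ.b) :
    γ.partInt f r t = γ.partInt f r s + γ.partInt f s t := by
  unfold partInt
  rw [← Set.Ioc_union_Ioc_eq_Ioc (arclen_mono hγ hr hrs (hst.trans ht))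
    (arclen_mono hγ (hr.trans hrs) hst ht),
    lintegral_union measurableSet_Ioc (Set.Ioc_disjoint_Ioc_of_le le_rfl)]

theorem pathIntegral_sub_le {γ : Curve X} (hγ : γ.Rectifiable) (f : X → ℝ≥0∞) {s t : ℝ}
    (hs : γ.a ≤ s) (hst : s ≤ t) (ht : t ≤ γ.b) :
    (γ.sub s t hs hst ht).pathIntegral f ≤ γ.pathIntegral f := by
  have h1 := pathIntegral_sub hγ f le_rfl γ.hab le_rfl
  rw [sub_self_eq] at h1
  rw [pathIntegral_sub hγ f, h1]
  exact lintegral_mono_set (Set.Ioc_subset_Ioc (arclen_mono hγ le_rfl hs (hst.trans ht))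
    (arclen_mono hγ (hs.trans hst) ht le_rfl))

theorem pathIntegral_mono {γ : Curve X} {f g : X → ℝ≥0∞}
    (hfg : ∀ t ∈ Set.Icc γ.a γ.b, f (γ.toFun t) ≤ g (γ.toFun t)) :
    γ.pathIntegral f ≤ γ.pathIntegral g := by
  refine setLIntegral_mono' measurableSet_Icc fun u hu => hfg _ ?_
  have hb : γ.b ∈ {t | t ∈ Set.Icc γ.a γ.b ∧ u ≤ γ.arclen t} := ⟨⟨γ.hab, le_rfl⟩, hu.2⟩
  exact ⟨le_csInf ⟨_, hb⟩ fun r hr => hr.1.1, csInf_le ⟨γ.a, fun r hr => hr.1.1⟩ hb⟩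

end Curve

/-- The two exceptional families combine to a null family. -/
theorem exceptional_null {X : Type*} [MetricSpace X] [MeasurableSpace X] [BorelSpace X]
    {p : ℝ} (hp : 1 < p) {m : Measure X} {U : Set X} (hU : IsOpen U) {N M : Set (Curve X)}
    (hN : PMod p m N = 0) (hM : PMod p (m.restrict U) M = 0) :
    PMod p m {γ : Curve X | ∃ s t hs hst ht, γ.sub s t hs hst ht ∈ N ∨
      ((γ.sub s t hs hst ht).In U ∧ γ.sub s t hs hst ht ∈ M)} = 0 := by
  have hp0 : 0 < p := by linarith
  refine le_antisymm (ENNReal.le_of_forall_pos_le_add fun ε hε _ => ?_) bot_le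
  have hε2 : (0 : ℝ≥0∞) < (ε : ℝ≥0∞) / 2 := ENNReal.half_pos (by exact_mod_cast hε.ne')
  have h1 := hN ▸ hε2
  have h2 := hM ▸ hε2
  unfold PMod at h1 h2
  simp only [iInf_lt_iff] at h1 h2
  obtain ⟨f, hf, hf'⟩ := h1
  obtain ⟨k, hk, hk'⟩ := h2
  set k' : X → ℝ≥0∞ := U.indicator k with hk'def
  have hk'm : Measurable k' := hk.1.indicator hU.measurableSet
  have hadm : Admissible (fun x => max (f x) (k' x)) {γ : Curve X | ∃ s t hs hst ht,
      γ.sub s t hs hst ht ∈ N ∨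
      ((γ.sub s t hs hst ht).In U ∧ γ.sub s t hs hst ht ∈ M)} := by
    refine ⟨hf.1.max hk'm, ?_⟩
    rintro γ ⟨s, t, hs, hst, ht, hγ | ⟨hin, hγ⟩⟩ hrect
    · refine (hf.2 _ hγ (Curve.sub_rectifiable hrect hs hst ht)).trans
        (le_trans ?_ (Curve.pathIntegral_sub_le hrect _ hs hst ht))
      exact Curve.pathIntegral_mono fun r _ => le_max_left _ _
    · refine (hk.2 _ hγ (Curve.sub_rectifiable hrect hs hst ht)).trans
        (le_trans ?_ (Curve.pathIntegral_sub_le hrect _ hs hst ht))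
      refine Curve.pathIntegral_mono fun r hr => le_trans ?_ (le_max_right _ _)
      rw [hk'def, Set.indicator_of_mem (hin r hr)]
  unfold PMod
  refine le_trans (iInf₂_le (fun x => max (f x) (k' x)) hadm) ?_
  calc ∫⁻ x, (max (f x) (k' x)) ^ p ∂m ≤ ∫⁻ x, (f x ^ p + k' x ^ p) ∂m := by
        refine lintegral_mono fun x => ?_
        rcases le_total (f x) (k' x) with hle | hle
        · simp only [max_eq_right hle]; exact le_add_self
        · simp only [max_eq_left hle]; exact le_self_add
    _ = ∫⁻ x, f x ^ p ∂m + ∫⁻ x, k' x ^ p ∂m := lintegral_add_left (hf.1.pow_const p) _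
    _ = ∫⁻ x, f x ^ p ∂m + ∫⁻ x in U, k x ^ p ∂m := by
        congr 1
        rw [← lintegral_indicator hU.measurableSet]
        refine lintegral_congr fun x => ?_
        by_cases hx : x ∈ U
        · simp [hk'def, hx]
        · simp [hk'def, hx, hp0]
    _ ≤ ε / 2 + ε / 2 := add_le_add hf'.le hk'.le
    _ = 0 + ε := by rw [ENNReal.add_halves, zero_add]

/-- Gluing along curves. -/
theorem glue_curve {X : Type*} [MetricSpace X] {Y : Type*} [PseudoMetricSpace Y]
    {h : X → Y} {U V : Set X} {δ : ℝ} (hδ : 0 < δ)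
    (hV : ∀ x ∈ V, ∀ y, dist x y < δ → y ∈ U) {ρ σ g : X → ℝ≥0∞}
    (hρg : ∀ x ∉ V, ρ x ≤ g x) (hσg : ∀ x ∈ U, σ x ≤ g x)
    {γ : Curve X} (hγ : γ.Rectifiable)
    (h1 : ∀ s t hs hst ht, ENNReal.ofReal (dist (h (γ.toFun s)) (h (γ.toFun t))) ≤
      (γ.sub s t hs hst ht).pathIntegral ρ)
    (h2 : ∀ s t hs hst ht, (γ.sub s t hs hst ht).In U →
      ENNReal.ofReal (dist (h (γ.toFun s)) (h (γ.toFun t))) ≤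
      (γ.sub s t hs hst ht).pathIntegral σ) :
    ENNReal.ofReal (dist (h (γ.toFun γ.a)) (h (γ.toFun γ.b))) ≤ γ.pathIntegral g := by
  simp only [← edist_dist] at h1 h2 ⊢
  have huc := isCompact_Icc.uniformContinuousOn_of_continuous γ.cont
  rw [Metric.uniformContinuousOn_iff] at huc
  obtain ⟨η, hη, huc⟩ := huc δ hδ
  -- short subcurves
  have hshort : ∀ s t, γ.a ≤ s → s ≤ t → t ≤ γ.b → t - s < η →
      edist (h (γ.toFun s)) (h (γ.toFun t)) ≤ γ.partInt g s t := by
    intro s t hs hst ht hlt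
    rw [← Curve.pathIntegral_sub hγ g hs hst ht]
    by_cases hmeet : ∃ r ∈ Set.Icc s t, γ.toFun r ∈ V
    · obtain ⟨r, hr, hrV⟩ := hmeet
      have hin : (γ.sub s t hs hst ht).In U := by
        intro q hq
        have hq' : q ∈ Set.Icc s t := hq
        refine hV _ hrV _ (huc r ⟨hs.trans hr.1, hr.2.trans ht⟩ q
          ⟨hs.trans hq'.1, hq'.2.trans ht⟩ ?_)
        rw [Real.dist_eq, abs_lt]
        constructor <;> linarith [hr.1, hr.2, hq'.1, hq'.2]
      exact (h2 s t hs hst ht hin).trans (Curve.pathIntegral_mono fun q hq => hσg _ (hin q hq))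
    · refine (h1 s t hs hst ht).trans (Curve.pathIntegral_mono fun q hq => hρg _ fun hqV => ?_)
      exact hmeet ⟨q, hq, hqV⟩
  have hind : ∀ n : ℕ, edist (h (γ.toFun γ.a)) (h (γ.toFun (min (γ.a + n * (η / 2)) γ.b))) ≤
      γ.partInt g γ.a (min (γ.a + n * (η / 2)) γ.b) := by
    intro n
    induction n with
    | zero => simp [min_eq_left γ.hab]
    | succ n ih =>
      have hn : (0 : ℝ) ≤ n * (η / 2) := by positivity
      have e : γ.a + ((n + 1 : ℕ) : ℝ) * (η / 2) = γ.a + n * (η / 2) + η / 2 := by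
        push_cast; ring
      rw [e]
      have hac : γ.a ≤ γ.a + n * (η / 2) := by linarith
      set c := γ.a + n * (η / 2)
      have hc : γ.a ≤ min c γ.b := le_min hac γ.hab
      have hcd : min c γ.b ≤ min (c + η / 2) γ.b := min_le_min_right _ (by linarith)
      have hd : min (c + η / 2) γ.b ≤ γ.b := min_le_right _ _
      have hlt : min (c + η / 2) γ.b - min c γ.b < η := by
        rcases le_total c γ.b with hle | hle
        · rw [min_eq_left hle]; linarith [min_le_left (c + η / 2) γ.b]
        · rw [min_eq_right hle]; linarith
      rw [Curve.partInt_add hγ g le_rfl hc hcd hd]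
      exact (edist_triangle _ _ _).trans (add_le_add ih (hshort _ _ hc hcd hd hlt))
  obtain ⟨n, hn⟩ := exists_nat_gt ((γ.b - γ.a) / (η / 2))
  have hb : min (γ.a + n * (η / 2)) γ.b = γ.b := by
    rw [div_lt_iff₀ (by positivity)] at hn
    exact min_eq_right (by linarith)
  have := hind n
  rw [hb, ← Curve.pathIntegral_sub hγ g le_rfl γ.hab le_rfl, Curve.sub_self_eq] at this
  exact this

/-- The minimal weak upper gradient restricts to the minimal one on open sets. -/
theorem minimal_restrict {X : Type*} [MetricSpace X] [MeasurableSpace X] [BorelSpace X]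
    {Y : Type*} [PseudoMetricSpace Y]
    {p : ℝ} (hp : 1 < p) {m : Measure X} {h : X → Y} {ρ : X → ℝ≥0∞}
    (hρ : (IsWUG p m h ρ ∧ LocPInt p m ρ) ∧
      ∀ g' : X → ℝ≥0∞, IsWUG p m h g' ∧ LocPInt p m g' → ∀ᵐ x ∂m, ρ x ≤ g' x)
    {U : Set X} (hU : IsOpen U) {σ : X → ℝ≥0∞}
    (hσ : (IsWUGOn p m U h σ ∧ LocPIntOn p m U σ) ∧
      ∀ g' : X → ℝ≥0∞, IsWUGOn p m U h g' ∧ LocPIntOn p m U g' →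
        ∀ᵐ x ∂(m.restrict U), σ x ≤ g' x) :
    ρ =ᵐ[m.restrict U] σ := by
  have hp0 : 0 ≤ p := by linarith
  obtain ⟨⟨⟨hρm, N, hN, hρN⟩, hρloc⟩, hρmin⟩ := hρ
  obtain ⟨⟨⟨hσm, M, hM, hσM⟩, hσloc⟩, hσmin⟩ := hσ
  have hle : ∀ᵐ x ∂(m.restrict U), σ x ≤ ρ x := by
    refine hσmin ρ ⟨⟨hρm, N, ?_, fun γ _ => hρN γ⟩, fun x _ => ?_⟩
    · refine le_antisymm (hN ▸ ?_) bot_le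
      exact iInf₂_mono fun f _ => lintegral_mono' Measure.restrict_le_self le_rfl
    · obtain ⟨V, hV, hxV, hfin⟩ := hρloc x
      exact ⟨V, hV, hxV, (lintegral_mono_set Set.inter_subset_left).trans_lt hfin⟩
  have hle' : ∀ᵐ x ∂m, x ∈ U → σ x ≤ ρ x := (ae_restrict_iff' hU.measurableSet).1 hle
  -- the glued functions
  have hkey : ∀ n : ℕ, ∀ᵐ x ∂m, ENNReal.ofReal (1 / (n + 1)) < Metric.infEDist x Uᶜ →
      ρ x ≤ σ x := by
    intro n
    have hδ : (0 : ℝ) < 1 / (n + 1) := by positivity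
    set δ : ℝ := 1 / (n + 1)
    set V : Set X := {x | ENNReal.ofReal δ < Metric.infEDist x Uᶜ} with hVdef
    have hVo : IsOpen V := isOpen_lt continuous_const Metric.continuous_infEDist
    have hV : ∀ x ∈ V, ∀ y, dist x y < δ → y ∈ U := by
      intro x hx y hxy
      by_contra hy
      have h1 : Metric.infEDist x Uᶜ ≤ edist x y := Metric.infEDist_le_edist_of_mem hy
      have h2 : ENNReal.ofReal δ < edist x y := lt_of_lt_of_le hx h1
      rw [edist_dist] at h2
      exact absurd (ENNReal.ofReal_le_ofReal hxy.le) (not_le.2 h2)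
    have hVU : V ⊆ U := fun x hx => hV x hx x (by simpa using hδ)
    classical
    set g : X → ℝ≥0∞ := V.piecewise σ (U.piecewise (fun x => max (ρ x) (σ x)) ρ) with hg
    have hgm : Measurable g :=
      hσm.piecewise hVo.measurableSet ((hρm.max hσm).piecewise hU.measurableSet hρm)
    have hρg : ∀ x ∉ V, ρ x ≤ g x := by
      intro x hx
      rw [hg, Set.piecewise_eq_of_notMem _ _ _ hx]
      by_cases hxU : x ∈ U
      · rw [Set.piecewise_eq_of_mem _ _ _ hxU]; exact le_max_left _ _
      · rw [Set.piecewise_eq_of_notMem _ _ _ hxU]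
    have hσg : ∀ x ∈ U, σ x ≤ g x := by
      intro x hxU
      by_cases hx : x ∈ V
      · rw [hg, Set.piecewise_eq_of_mem _ _ _ hx]
      · rw [hg, Set.piecewise_eq_of_notMem _ _ _ hx, Set.piecewise_eq_of_mem _ _ _ hxU]
        exact le_max_right _ _
    have hgle : ∀ᵐ x ∂m, g x ≤ ρ x := by
      filter_upwards [hle'] with x hx
      by_cases hxV : x ∈ V
      · rw [hg, Set.piecewise_eq_of_mem _ _ _ hxV]; exact hx (hVU hxV)
      · rw [hg, Set.piecewise_eq_of_notMem _ _ _ hxV]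
        by_cases hxU : x ∈ U
        · rw [Set.piecewise_eq_of_mem _ _ _ hxU]; exact max_le le_rfl (hx hxU)
        · rw [Set.piecewise_eq_of_notMem _ _ _ hxU]
    have hmin := hρmin g ⟨⟨hgm, _, exceptional_null hp hU hN hM, ?_⟩, ?_⟩
    · filter_upwards [hmin] with x hx hxV
      have hxV' : x ∈ V := hxV
      rwa [hg, Set.piecewise_eq_of_mem _ _ _ hxV'] at hx
    · intro γ hγ hrect
      refine glue_curve hδ hV hρg hσg hrect (fun s t hs hst ht => ?_) fun s t hs hst ht hin => ?_
      · exact hρN (γ.sub s t hs hst ht) (fun hmem => hγ ⟨s, t, hs, hst, ht, Or.inl hmem⟩)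
          (Curve.sub_rectifiable hrect hs hst ht)
      · exact hσM (γ.sub s t hs hst ht) hin
          (fun hmem => hγ ⟨s, t, hs, hst, ht, Or.inr ⟨hin, hmem⟩⟩)
          (Curve.sub_rectifiable hrect hs hst ht)
    · intro x
      obtain ⟨W, hW, hxW, hfin⟩ := hρloc x
      refine ⟨W, hW, hxW, lt_of_le_of_lt (lintegral_mono_ae ?_) hfin⟩
      filter_upwards [ae_restrict_of_ae hgle] with y hy
      exact ENNReal.rpow_le_rpow hy hp0
  have hge : ∀ᵐ x ∂(m.restrict U), ρ x ≤ σ x := by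
    rw [ae_restrict_iff' hU.measurableSet]
    filter_upwards [ae_all_iff.2 hkey] with x hx hxU
    have hpos : 0 < Metric.infEDist x Uᶜ := by
      rw [pos_iff_ne_zero]
      intro h0
      have := (Metric.mem_iff_infEDist_zero_of_closed hU.isClosed_compl).2 h0
      exact this hxU
    obtain ⟨r, hr0, hr⟩ := ENNReal.lt_iff_exists_real_btwn.1 hpos
    have hr' : 0 < r := by simpa using hr.1
    obtain ⟨n, hn⟩ := exists_nat_one_div_lt hr'
    exact hx n (lt_of_le_of_lt (ENNReal.ofReal_le_ofReal hn.le) hr.2)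
  filter_upwards [hle, hge] with x h1 h2 using le_antisymm h2 h1

/-- Locality of the minimal weak upper gradient: let `ρ` be the minimal weak upper
gradient of `h`, and for each open `U` let `ρU U` be the minimal weak upper gradient of
`h` restricted to `U`. Then a function `g ∈ L^p_loc(m)` agrees `m`-a.e. with `ρ` iff it
agrees `m`-a.e. on `U` with `ρU U` for every open `U`. -/
theorem locality_minimal_wug {X : Type*} [MetricSpace X] [MeasurableSpace X] [BorelSpace X]
    {Y : Type*} [PseudoMetricSpace Y]
    (p : ℝ) (hp : 1 < p) (m : Measure X) (h : X → Y)
    (ρ : X → ℝ≥0∞)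
    (hρ : (IsWUG p m h ρ ∧ LocPInt p m ρ) ∧
      ∀ g' : X → ℝ≥0∞, IsWUG p m h g' ∧ LocPInt p m g' → ∀ᵐ x ∂m, ρ x ≤ g' x)
    (ρU : Set X → X → ℝ≥0∞)
    (hρU : ∀ U : Set X, IsOpen U →
      (IsWUGOn p m U h (ρU U) ∧ LocPIntOn p m U (ρU U)) ∧
      ∀ g' : X → ℝ≥0∞, IsWUGOn p m U h g' ∧ LocPIntOn p m U g' →
        ∀ᵐ x ∂(m.restrict U), ρU U x ≤ g' x)
    (g : X → ℝ≥0∞) (hgm : Measurable g) (hgloc : LocPInt p m g) :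
    (g =ᵐ[m] ρ) ↔ ∀ U : Set X, IsOpen U → g =ᵐ[m.restrict U] ρU U := by
  constructor
  · intro hg U hU
    have hg' : g =ᵐ[m.restrict U] ρ := ae_restrict_of_ae hg
    exact hg'.trans (minimal_restrict hp hρ hU (hρU U hU))
  · intro hg
    have h1 := hg Set.univ isOpen_univ
    have h2 := minimal_restrict hp hρ isOpen_univ (hρU Set.univ isOpen_univ)
    rw [Measure.restrict_univ] at h1 h2
    exact h1.trans h2.symm
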